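/- Let p be a prime, A ∈ ℤ^{m×n}, b ∈ ℤ^m, and P := {x : Ax ≤ b} nonempty. Then the following are equivalent: (1) P is a p-adic polyhedron; (2) for every nonempty face F of P, the affine hull of F contains a p-adic point; (3) for every nonempty face F of P and every vector z, if A_Fᵀz is integral then b_Fᵀz is a p-adic rational; (4) for every w ∈ ℝ^n for which max{wᵀx : x ∈ P} has an optimal solution, it has a p-adic optimal solution; (5) for every w ∈ ℤ^n for which max{wᵀx : x ∈ P} has an optimal solution, its optimal value is a p-adic rational. -/

import Mathlib

open Finset

attribute [local instance] Classical.propDecidable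

/-- A real number is `p`-adic if it has the form `a / p^k` for integers `a, k`, `k ≥ 0`. -/
def IsPadic (p : ℕ) (r : ℝ) : Prop := ∃ (a : ℤ) (k : ℕ), r = (a : ℝ) / (p : ℝ) ^ k

/-- A finite family of integral vectors is a `p`-adic generating set for a cone if every
integral vector in its conic hull is a conic combination of the vectors with `p`-adic
coefficients. -/
def IsPGSC (p : ℕ) {ι d : Type} [Fintype ι] [Fintype d] (a : ι → d → ℤ) : Prop :=
  ∀ w : d → ℤ,
    (∃ lam : ι → ℝ, (∀ i, 0 ≤ lam i) ∧ ∀ j, ∑ i, lam i * (a i j : ℝ) = (w j : ℝ)) →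
    ∃ lam : ι → ℝ, (∀ i, 0 ≤ lam i) ∧ (∀ i, IsPadic p (lam i)) ∧
      ∀ j, ∑ i, lam i * (a i j : ℝ) = (w j : ℝ)

/-- A finite family of integral vectors is a `p`-adic generating set for a subspace if every
integral vector in its linear hull is a linear combination of the vectors with `p`-adic
coefficients. -/
def IsPGSS (p : ℕ) {ι d : Type} [Fintype ι] [Fintype d] (a : ι → d → ℤ) : Prop :=
  ∀ w : d → ℤ,
    (∃ lam : ι → ℝ, ∀ j, ∑ i, lam i * (a i j : ℝ) = (w j : ℝ)) →
    ∃ lam : ι → ℝ, (∀ i, IsPadic p (lam i)) ∧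
      ∀ j, ∑ i, lam i * (a i j : ℝ) = (w j : ℝ)

/-- `F` is a face of `P`: the intersection of `P` with a supporting hyperplane (this includes
`P` itself, via `c = 0, δ = 0`). -/
def IsFace {d : Type} [Fintype d] (P F : Set (d → ℝ)) : Prop :=
  ∃ (c : d → ℝ) (δ : ℝ), (∀ x ∈ P, ∑ j, c j * x j ≤ δ) ∧
    F = {x ∈ P | ∑ j, c j * x j = δ}

/-- `y` is feasible for the dual LP `min {bᵀy : Aᵀy = w, y ≥ 0}`. -/
def DualFeasible {m n : ℕ} (A : Matrix (Fin m) (Fin n) ℤ) (w : Fin n → ℤ)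
    (y : Fin m → ℝ) : Prop :=
  (∀ i, 0 ≤ y i) ∧ ∀ j, ∑ i, y i * (A i j : ℝ) = (w j : ℝ)

/-- `y` is an optimal solution of the dual LP `min {bᵀy : Aᵀy = w, y ≥ 0}`. -/
def DualOptimal {m n : ℕ} (A : Matrix (Fin m) (Fin n) ℤ) (b : Fin m → ℤ) (w : Fin n → ℤ)
    (y : Fin m → ℝ) : Prop :=
  DualFeasible A w y ∧
    ∀ y', DualFeasible A w y' → ∑ i, (b i : ℝ) * y i ≤ ∑ i, (b i : ℝ) * y' i

/-- The system `Ax ≤ b` is totally dual `p`-adic. -/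
def TotallyDualPadic (p : ℕ) {m n : ℕ} (A : Matrix (Fin m) (Fin n) ℤ) (b : Fin m → ℤ) : Prop :=
  ∀ w : Fin n → ℤ, (∃ y, DualOptimal A b w y) →
    ∃ y, DualOptimal A b w y ∧ ∀ i, IsPadic p (y i)

lemma isPadic_int (p : ℕ) (a : ℤ) : IsPadic p (a : ℝ) := ⟨a, 0, by simp⟩

lemma IsPadic.add' {p : ℕ} (hp : p.Prime) {r s : ℝ} (hr : IsPadic p r) (hs : IsPadic p s) :
    IsPadic p (r + s) := by
  obtain ⟨a, k, rfl⟩ := hr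
  obtain ⟨c, l, rfl⟩ := hs
  have h0 : (p : ℝ) ≠ 0 := by exact_mod_cast hp.ne_zero
  refine ⟨a * p ^ l + c * p ^ k, k + l, ?_⟩
  push_cast
  rw [pow_add]
  field_simp

lemma IsPadic.mul' {p : ℕ} {r s : ℝ} (hr : IsPadic p r) (hs : IsPadic p s) :
    IsPadic p (r * s) := by
  obtain ⟨a, k, rfl⟩ := hr
  obtain ⟨c, l, rfl⟩ := hs
  refine ⟨a * c, k + l, ?_⟩
  push_cast
  rw [pow_add, div_mul_div_comm]

lemma isPadic_sum {p : ℕ} (hp : p.Prime) {ι : Type*} (s : Finset ι) (f : ι → ℝ)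
    (h : ∀ i ∈ s, IsPadic p (f i)) : IsPadic p (∑ i ∈ s, f i) := by
  refine Finset.sum_induction f (IsPadic p) (fun _ _ => IsPadic.add' hp) ?_ h
  simpa using isPadic_int p 0

lemma isPadic_dense {p : ℕ} (hp : p.Prime) : Dense {r : ℝ | IsPadic p r} := by
  have h1 : (1 : ℝ) < p := by exact_mod_cast hp.one_lt
  have h0 : (0 : ℝ) < p := by linarith
  rw [Metric.dense_iff]
  intro t ε hε
  obtain ⟨k, hk⟩ := exists_pow_lt_of_lt_one hε (inv_lt_one_of_one_lt₀ h1)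
  refine ⟨(⌊t * p ^ k⌋ : ℝ) / p ^ k, ?_, ⟨_, _, rfl⟩⟩
  rw [Metric.mem_ball, dist_comm, Real.dist_eq]
  have hpk : (0 : ℝ) < (p : ℝ) ^ k := by positivity
  have h2 := Int.floor_le (t * (p : ℝ) ^ k)
  have h3 := Int.lt_floor_add_one (t * (p : ℝ) ^ k)
  have h4 : t - (⌊t * p ^ k⌋ : ℝ) / p ^ k = (t * p ^ k - ⌊t * (p : ℝ) ^ k⌋) * (p : ℝ)⁻¹ ^ k := by
    rw [inv_pow]
    field_simp
  have h5 : (0 : ℝ) < (p : ℝ)⁻¹ ^ k := by positivity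
  rw [h4, abs_of_nonneg (mul_nonneg (by linarith) h5.le)]
  nlinarith

lemma not_isPadic_sqrt_two {p : ℕ} : ¬ IsPadic p (Real.sqrt 2) := by
  rintro ⟨a, k, h⟩
  apply irrational_sqrt_two
  exact ⟨(a : ℚ) / (p : ℚ) ^ k, by rw [h]; push_cast; rfl⟩

/-- The integral Farkas alternative over `ℤ[1/p]`. -/
lemma padic_solution {p : ℕ} (hp : p.Prime) {ι κ : Type} [Fintype ι] [Fintype κ]
    (A : ι → κ → ℤ) (b : ι → ℤ)
    (h : ∀ z : ι → ℝ, (∀ j, ∃ c : ℤ, ∑ i, z i * (A i j : ℝ) = (c : ℝ)) →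
      IsPadic p (∑ i, z i * (b i : ℝ))) :
    ∃ x : κ → ℝ, (∀ j, IsPadic p (x j)) ∧ ∀ i, ∑ j, (A i j : ℝ) * x j = (b i : ℝ) := by
  classical
  let T : (κ → ℤ) →ₗ[ℤ] (ι → ℤ) := Matrix.mulVecLin (Matrix.of A)
  have hT : ∀ x i, T x i = ∑ j, A i j * x j := fun x i => rfl
  obtain ⟨r, S⟩ := Submodule.smithNormalForm (Pi.basisFun ℤ ι) (LinearMap.range T)
  -- coordinates
  have hcoord : ∀ k (v : ι → ℤ), S.bM.repr v k = ∑ i, S.bM.repr (Pi.single i 1) k * v i := by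
    intro k v
    have := congrArg (fun u => S.bM.repr u k) (pi_eq_sum_univ' v)
    simp only [map_sum, map_smul, Finsupp.coe_finsetSum, Finset.sum_apply, Finsupp.smul_apply,
      smul_eq_mul] at this
    rw [this]
    refine Finset.sum_congr rfl fun i _ => ?_
    rw [mul_comm]
  have key : ∀ k (t : ℝ), (∀ j, ∃ c : ℤ, t * (S.bM.repr (T (Pi.single j 1)) k : ℝ) = c) →
      IsPadic p (t * (S.bM.repr b k : ℝ)) := by
    intro k t ht
    have := h (fun i => t * (S.bM.repr (Pi.single i 1) k : ℝ)) (by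
      intro j
      obtain ⟨c, hc⟩ := ht j
      refine ⟨c, ?_⟩
      rw [← hc, hcoord k (T _)]
      push_cast
      rw [Finset.mul_sum]
      refine Finset.sum_congr rfl fun i _ => ?_
      have : T (Pi.single j 1) i = A i j := by simp [hT, Pi.single_apply]
      rw [this]
      ring)
    rw [hcoord k b]
    push_cast
    rw [Finset.mul_sum]
    simpa [mul_assoc] using this
  -- coordinates outside the range vanish
  have hout : ∀ k, k ∉ Set.range S.f → S.bM.repr b k = 0 := by
    intro k hk
    by_contra hne
    have hne' : (S.bM.repr b k : ℝ) ≠ 0 := by exact_mod_cast hne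
    have := key k (Real.sqrt 2 / (S.bM.repr b k : ℝ)) (by
      intro j
      refine ⟨0, ?_⟩
      have : S.bM.repr (T (Pi.single j 1)) k = 0 :=
        S.repr_eq_zero_of_notMem_range ⟨T (Pi.single j 1), LinearMap.mem_range_self _ _⟩ hk
      simp [this])
    rw [div_mul_cancel₀ _ hne'] at this
    exact not_isPadic_sqrt_two this
  have ha : ∀ l, S.a l ≠ 0 := by
    intro l hl
    have h1 := S.snf l
    rw [hl, zero_smul] at h1
    exact S.bN.ne_zero l (Subtype.ext h1)
  have hin : ∀ l, IsPadic p ((S.bM.repr b (S.f l) : ℝ) / (S.a l : ℝ)) := by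
    intro l
    have := key (S.f l) (1 / (S.a l : ℝ)) (by
      intro j
      have h1 := S.repr_apply_embedding_eq_repr_smul
        (m := ⟨T (Pi.single j 1), LinearMap.mem_range_self _ _⟩) (i := l)
      have ha' : (S.a l : ℝ) ≠ 0 := by exact_mod_cast ha l
      simp only [map_smul] at h1
      have h2 : S.bM.repr (T (Pi.single j 1)) (S.f l) = S.a l *
        (S.bN.repr ⟨T (Pi.single j 1), LinearMap.mem_range_self _ _⟩ l) := by
          simpa using h1
      refine ⟨S.bN.repr ⟨T (Pi.single j 1), LinearMap.mem_range_self _ _⟩ l, ?_⟩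
      rw [h2]
      push_cast
      field_simp)
    rwa [one_div_mul_eq_div] at this
  have hpre : ∀ l, ∃ x, T x = S.a l • S.bM (S.f l) := by
    intro l
    obtain ⟨x, hx⟩ := (S.bN l).2
    exact ⟨x, by rw [hx, S.snf]⟩
  choose X hX using hpre
  refine ⟨fun j => ∑ l, ((S.bM.repr b (S.f l) : ℝ) / (S.a l : ℝ)) * (X l j : ℝ), ?_, ?_⟩
  · intro j
    exact isPadic_sum hp _ _ fun l _ => (hin l).mul' (isPadic_int p _)
  · intro i
    have hb : b = ∑ l, S.bM.repr b (S.f l) • S.bM (S.f l) := by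
      conv_lhs => rw [← S.bM.sum_repr b]
      symm
      rw [← Finset.sum_map Finset.univ S.f (fun k => S.bM.repr b k • S.bM k)]
      refine Finset.sum_subset (Finset.subset_univ _) ?_
      intro k _ hk
      rw [hout k, zero_smul]
      rintro ⟨l, rfl⟩
      exact hk (by simp)
    have hbi : (b i : ℝ) = ∑ l, (S.bM.repr b (S.f l) : ℝ) * (S.bM (S.f l) i : ℝ) := by
      have := congrFun hb i
      simp only [Finset.sum_apply, Pi.smul_apply, smul_eq_mul] at this
      have h2 := congrArg (fun u : ℤ => (u : ℝ)) this
      simpa using h2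
    rw [hbi]
    simp only [Finset.mul_sum]
    rw [Finset.sum_comm]
    refine Finset.sum_congr rfl fun l _ => ?_
    have h1 := congrFun (hX l) i
    rw [hT] at h1
    simp only [Pi.smul_apply, smul_eq_mul] at h1
    have h2 : ∑ j, (A i j : ℝ) * (X l j : ℝ) = (S.a l : ℝ) * (S.bM (S.f l) i : ℝ) := by
      exact_mod_cast h1
    have ha' : (S.a l : ℝ) ≠ 0 := by exact_mod_cast ha l
    have h3 : ∀ j, (A i j : ℝ) * ((S.bM.repr b (S.f l) : ℝ) / (S.a l : ℝ) * (X l j : ℝ)) =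
      ((S.bM.repr b (S.f l) : ℝ) / (S.a l : ℝ)) * ((A i j : ℝ) * (X l j : ℝ)) := fun j => by ring
    simp only [h3]
    rw [← Finset.mul_sum, h2]
    field_simp

/-- A real kernel vector of an integer matrix is a real combination of integral kernel vectors. -/
lemma kernel_integral {ι κ : Type} [Fintype κ] (A : ι → κ → ℤ) (d : κ → ℝ)
    (hd : ∀ i, ∑ j, (A i j : ℝ) * d j = 0) :
    ∃ (r : ℕ) (e : Fin r → ℝ) (q : Fin r → κ → ℤ),
      (∀ k i, ∑ j, A i j * q k j = 0) ∧ ∀ j, d j = ∑ k, e k * (q k j : ℝ) := by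
  let M : Submodule ℤ ℝ := Submodule.span ℤ (Set.range d)
  have : Module.Finite ℤ M := Module.Finite.span_of_finite ℤ (Set.finite_range d)
  let B := Module.finBasis ℤ M
  let D : κ → M := fun j => ⟨d j, Submodule.subset_span ⟨j, rfl⟩⟩
  refine ⟨_, fun k => (B k : ℝ), fun k j => B.repr (D j) k, ?_, ?_⟩
  · intro k i
    have h1 : ∑ j, A i j • D j = 0 := by
      apply Subtype.ext
      have := hd i
      simpa [D] using this
    have h2 := congrArg (fun u => B.repr u k) h1
    simpa using h2
  · intro j
    have h1 := congrArg (fun u : M => (u : ℝ)) (B.sum_repr (D j))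
    simp only [Submodule.coe_sum, Submodule.coe_smul, zsmul_eq_mul] at h1
    rw [show d j = (D j : ℝ) from rfl, ← h1]
    exact Finset.sum_congr rfl fun k _ => mul_comm _ _

/-- A relative interior point of a face. -/
lemma exists_rel_int {m n : ℕ} (A : Matrix (Fin m) (Fin n) ℤ) (b : Fin m → ℤ)
    (F : Set (Fin n → ℝ)) (hF : Convex ℝ F) (hne : F.Nonempty)
    (hle : ∀ x ∈ F, ∀ i, ∑ j, (A i j : ℝ) * x j ≤ (b i : ℝ)) :
    ∃ x ∈ F, ∀ i, (¬ ∀ x ∈ F, ∑ j, (A i j : ℝ) * x j = (b i : ℝ)) →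
      ∑ j, (A i j : ℝ) * x j < (b i : ℝ) := by
  suffices H : ∀ s : Finset (Fin m), ∃ x ∈ F, ∀ i ∈ s,
      (¬ ∀ x ∈ F, ∑ j, (A i j : ℝ) * x j = (b i : ℝ)) →
      ∑ j, (A i j : ℝ) * x j < (b i : ℝ) by
    obtain ⟨x, hx, h⟩ := H Finset.univ
    exact ⟨x, hx, fun i => h i (Finset.mem_univ i)⟩
  intro s
  induction s using Finset.induction_on with
  | empty => exact ⟨hne.some, hne.some_mem, by simp⟩
  | insert i s his ih =>
    obtain ⟨x, hx, h⟩ := ih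
    by_cases hi : ∀ x ∈ F, ∑ j, (A i j : ℝ) * x j = (b i : ℝ)
    · refine ⟨x, hx, fun k hk hk' => ?_⟩
      rcases Finset.mem_insert.1 hk with rfl | hk
      · exact absurd hi hk'
      · exact h k hk hk'
    · have hi2 := hi
      push Not at hi2
      obtain ⟨y, hy, hyi⟩ := hi2
      have hylt := lt_of_le_of_ne (hle y hy i) hyi
      refine ⟨(1/2 : ℝ) • x + (1/2 : ℝ) • y,
        hF hx hy (by norm_num) (by norm_num) (by norm_num), fun k hk hk' => ?_⟩
      have hs : ∑ j, (A k j : ℝ) * ((1/2 : ℝ) • x + (1/2 : ℝ) • y) j =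
          (1/2) * ∑ j, (A k j : ℝ) * x j + (1/2) * ∑ j, (A k j : ℝ) * y j := by
        rw [Finset.mul_sum, Finset.mul_sum, ← Finset.sum_add_distrib]
        refine Finset.sum_congr rfl fun j _ => ?_
        simp only [Pi.add_apply, Pi.smul_apply, smul_eq_mul]
        ring
      rw [hs]
      have hxk := hle x hx k
      have hyk := hle y hy k
      rcases Finset.mem_insert.1 hk with rfl | hk
      · linarith
      · have := h k hk hk'
        linarith

/-- If the implicit equalities of a face have a `p`-adic solution, the face contains a `p`-adic
point. -/
lemma face_padic {m n : ℕ} {p : ℕ} (hp : p.Prime)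
    (A : Matrix (Fin m) (Fin n) ℤ) (b : Fin m → ℤ) (F : Set (Fin n → ℝ))
    (hF : IsFace {x | ∀ i, ∑ j, (A i j : ℝ) * x j ≤ (b i : ℝ)} F) (hne : F.Nonempty)
    (x1 : Fin n → ℝ) (hx1 : ∀ j, IsPadic p (x1 j))
    (h1 : ∀ i, (∀ x ∈ F, ∑ j, (A i j : ℝ) * x j = (b i : ℝ)) →
      ∑ j, (A i j : ℝ) * x1 j = (b i : ℝ)) :
    ∃ x ∈ F, ∀ j, IsPadic p (x j) := by
  obtain ⟨c, δ, hc, rfl⟩ := hF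
  set P : Set (Fin n → ℝ) := {x | ∀ i, ∑ j, (A i j : ℝ) * x j ≤ (b i : ℝ)} with hP
  set F : Set (Fin n → ℝ) := {x ∈ P | ∑ j, c j * x j = δ} with hFdef
  have hlin : ∀ (v x y : Fin n → ℝ) (s t : ℝ), ∑ j, v j * (s • x + t • y) j =
      s * ∑ j, v j * x j + t * ∑ j, v j * y j := by
    intro v x y s t
    rw [Finset.mul_sum, Finset.mul_sum, ← Finset.sum_add_distrib]
    refine Finset.sum_congr rfl fun j _ => ?_
    simp only [Pi.add_apply, Pi.smul_apply, smul_eq_mul]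
    ring
  have hconv : Convex ℝ F := by
    intro x hx y hy s t hs ht hst
    refine ⟨fun i => ?_, ?_⟩
    · rw [hlin (fun j => (A i j : ℝ))]
      have hx' := mul_le_mul_of_nonneg_left (hx.1 i) hs
      have hy' := mul_le_mul_of_nonneg_left (hy.1 i) ht
      calc _ ≤ s * (b i : ℝ) + t * (b i : ℝ) := add_le_add hx' hy'
        _ = (b i : ℝ) := by rw [← add_mul, hst, one_mul]
    · rw [hlin c, hx.2, hy.2, ← add_mul, hst, one_mul]
  obtain ⟨x0, hx0, hint⟩ := exists_rel_int A b F hconv hne (fun x hx => hx.1)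
  obtain ⟨r, e, q, hq, hd⟩ := kernel_integral
    (fun (i : {i : Fin m // ∀ x ∈ F, ∑ j, (A i j : ℝ) * x j = (b i : ℝ)}) j => A i.1 j)
    (fun j => x0 j - x1 j) (by
      intro i
      simp only [mul_sub, Finset.sum_sub_distrib]
      rw [i.2 x0 hx0, h1 i.1 i.2, sub_self])
  let g : (Fin r → ℝ) → (Fin n → ℝ) := fun s j => x1 j + ∑ k, s k * (q k j : ℝ)
  have hge : g e = x0 := by
    funext j
    simp only [g]
    rw [← hd j]
    ring
  let U : Set (Fin r → ℝ) := {s | ∀ i, (¬ ∀ x ∈ F, ∑ j, (A i j : ℝ) * x j = (b i : ℝ)) →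
      ∑ j, (A i j : ℝ) * g s j < (b i : ℝ)}
  have hU : IsOpen U := by
    have : U = ⋂ i, ⋂ (_ : ¬ ∀ x ∈ F, ∑ j, (A i j : ℝ) * x j = (b i : ℝ)),
        {s | ∑ j, (A i j : ℝ) * g s j < (b i : ℝ)} := by
      ext s
      simp only [U, Set.mem_iInter, Set.mem_ofPred_eq]
    rw [this]
    refine isOpen_iInter_of_finite fun i => isOpen_iInter_of_finite fun _ => ?_
    refine isOpen_lt ?_ continuous_const
    simp only [g]
    fun_prop
  have hdense : Dense (Set.pi Set.univ (fun _ : Fin r => {t : ℝ | IsPadic p t})) :=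
    dense_pi _ fun _ _ => isPadic_dense hp
  obtain ⟨s, hsU, hs⟩ := hdense.inter_open_nonempty U hU ⟨e, by
    intro i hi
    rw [hge]
    exact hint i hi⟩
  have hEq : ∀ i, (∀ x ∈ F, ∑ j, (A i j : ℝ) * x j = (b i : ℝ)) →
      ∑ j, (A i j : ℝ) * g s j = (b i : ℝ) := by
    intro i hi
    simp only [g, mul_add, Finset.sum_add_distrib, Finset.mul_sum]
    rw [h1 i hi, Finset.sum_comm, add_eq_left]
    refine Finset.sum_eq_zero fun k _ => ?_
    have h2 : ∑ j, (A i j : ℝ) * (q k j : ℝ) = 0 := by exact_mod_cast hq k ⟨i, hi⟩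
    have h3 : ∀ j, (A i j : ℝ) * (s k * (q k j : ℝ)) = s k * ((A i j : ℝ) * (q k j : ℝ)) :=
      fun j => by ring
    simp only [h3]
    rw [← Finset.mul_sum, h2, mul_zero]
  have hgP : g s ∈ P := by
    intro i
    by_cases hi : ∀ x ∈ F, ∑ j, (A i j : ℝ) * x j = (b i : ℝ)
    · exact (hEq i hi).le
    · exact (hsU i hi).le
  refine ⟨g s, ⟨hgP, ?_⟩, ?_⟩
  · -- the objective is constant
    apply le_antisymm (hc _ hgP)
    -- move slightly past x0 away from g s
    have hnear : ∀ᶠ t : ℝ in nhds 0, ∀ i,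
        (¬ ∀ x ∈ F, ∑ j, (A i j : ℝ) * x j = (b i : ℝ)) →
        ∑ j, (A i j : ℝ) * ((1 + t) • x0 + (-t) • g s) j < (b i : ℝ) := by
      rw [Filter.eventually_all]
      intro i
      by_cases hi : ∀ x ∈ F, ∑ j, (A i j : ℝ) * x j = (b i : ℝ)
      · exact Filter.Eventually.of_forall fun t h => absurd hi h
      · have hcont : Continuous fun t : ℝ =>
            ∑ j, (A i j : ℝ) * ((1 + t) • x0 + (-t) • g s) j := by
          simp only [Pi.add_apply, Pi.smul_apply, smul_eq_mul]
          fun_prop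
        have := hcont.continuousAt.eventually_lt (continuousAt_const (y := (b i : ℝ)) (x := 0))
          (by simpa using hint i hi)
        exact this.mono fun t ht _ => ht
    obtain ⟨ε, hε, hball⟩ := Metric.eventually_nhds_iff.1 hnear
    have hh := hball (y := ε / 2) (by
      rw [Real.dist_eq, sub_zero, abs_of_pos (by linarith)]
      linarith)
    have hyP : (1 + ε / 2) • x0 + (-(ε / 2)) • g s ∈ P := by
      intro i
      by_cases hi : ∀ x ∈ F, ∑ j, (A i j : ℝ) * x j = (b i : ℝ)
      · rw [hlin (fun j => (A i j : ℝ)), hi x0 hx0, hEq i hi]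
        apply le_of_eq
        ring
      · exact (hh i hi).le
    have h5 := hc _ hyP
    rw [hlin c, hx0.2] at h5
    nlinarith
  · intro j
    exact (hx1 j).add' hp (isPadic_sum hp _ _ fun k _ =>
      IsPadic.mul' (hs k (Set.mem_univ k)) (isPadic_int p _))

/-- Characterization of `p`-adic polyhedra: for nonempty
`P = {x : Ax ≤ b}` with `A, b` integral, the following are equivalent:
(1) every nonempty face of `P` contains a `p`-adic point;
(2) the affine hull of every nonempty face of `P` contains a `p`-adic point;
(3) for every nonempty face `F` of `P` and every `z`, if `A_Fᵀ z` is integral then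
`b_Fᵀ z` is a `p`-adic rational;
(4) for every `w ∈ ℝ^n` for which `max {wᵀx : x ∈ P}` has an optimal solution, it has a
`p`-adic optimal solution;
(5) for every `w ∈ ℤ^n` for which `max {wᵀx : x ∈ P}` has an optimal solution, the optimal
value is a `p`-adic rational. -/
theorem padic_polyhedra_characterization {m n : ℕ} (p : ℕ) (hp : p.Prime)
    (A : Matrix (Fin m) (Fin n) ℤ) (b : Fin m → ℤ) (P : Set (Fin n → ℝ))
    (hPdef : P = {x | ∀ i, ∑ j, (A i j : ℝ) * x j ≤ (b i : ℝ)})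
    (hPne : P.Nonempty) :
    ((∀ F, IsFace P F → F.Nonempty → ∃ x ∈ F, ∀ j, IsPadic p (x j)) ↔
      (∀ F, IsFace P F → F.Nonempty →
        ∃ x ∈ (affineSpan ℝ F : AffineSubspace ℝ (Fin n → ℝ)),
          ∀ j, IsPadic p (x j))) ∧
    ((∀ F, IsFace P F → F.Nonempty → ∃ x ∈ F, ∀ j, IsPadic p (x j)) ↔
      (∀ F, IsFace P F → F.Nonempty →
        ∀ z : {i : Fin m // ∀ x ∈ F, ∑ j, (A i j : ℝ) * x j = (b i : ℝ)} → ℝ,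
          (∀ j, ∃ c : ℤ, ∑ i, z i * (A i.1 j : ℝ) = (c : ℝ)) →
          IsPadic p (∑ i, z i * (b i.1 : ℝ)))) ∧
    ((∀ F, IsFace P F → F.Nonempty → ∃ x ∈ F, ∀ j, IsPadic p (x j)) ↔
      (∀ w : Fin n → ℝ,
        (∃ x, x ∈ P ∧ ∀ x' ∈ P, ∑ j, w j * x' j ≤ ∑ j, w j * x j) →
        (∃ x, (x ∈ P ∧ ∀ x' ∈ P, ∑ j, w j * x' j ≤ ∑ j, w j * x j) ∧
          ∀ j, IsPadic p (x j)))) ∧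
    ((∀ F, IsFace P F → F.Nonempty → ∃ x ∈ F, ∀ j, IsPadic p (x j)) ↔
      (∀ w : Fin n → ℤ, ∀ x,
        (x ∈ P ∧ ∀ x' ∈ P, ∑ j, (w j : ℝ) * x' j ≤ ∑ j, (w j : ℝ) * x j) →
        IsPadic p (∑ j, (w j : ℝ) * x j))) := by
  subst hPdef
  set P : Set (Fin n → ℝ) := {x | ∀ i, ∑ j, (A i j : ℝ) * x j ≤ (b i : ℝ)} with hP
  have h12 : (∀ F, IsFace P F → F.Nonempty → ∃ x ∈ F, ∀ j, IsPadic p (x j)) →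
      (∀ F, IsFace P F → F.Nonempty →
        ∃ x ∈ (affineSpan ℝ F : AffineSubspace ℝ (Fin n → ℝ)),
          ∀ j, IsPadic p (x j)) := by
    intro h F hF hne
    obtain ⟨x, hx, hx'⟩ := h F hF hne
    exact ⟨x, subset_affineSpan ℝ F hx, hx'⟩
  have hspan : ∀ (F : Set (Fin n → ℝ)) (x : Fin n → ℝ), x ∈ affineSpan ℝ F → ∀ i,
      (∀ x ∈ F, ∑ j, (A i j : ℝ) * x j = (b i : ℝ)) → ∑ j, (A i j : ℝ) * x j = (b i : ℝ) := by
    intro F x hx i hi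
    refine affineSpan_induction (p := fun x => ∑ j, (A i j : ℝ) * x j = (b i : ℝ)) hx hi ?_
    · intro c u v w hu hv hw
      simp only [vsub_eq_sub, vadd_eq_add, Pi.add_apply, Pi.smul_apply, Pi.sub_apply, smul_eq_mul]
      have : ∀ j, (A i j : ℝ) * (c * (u j - v j) + w j) =
        c * ((A i j : ℝ) * u j) - c * ((A i j : ℝ) * v j) + (A i j : ℝ) * w j := fun j => by ring
      simp only [this, Finset.sum_add_distrib, Finset.sum_sub_distrib, ← Finset.mul_sum]
      rw [hu, hv, hw]
      ring
  have h21 : (∀ F, IsFace P F → F.Nonempty →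
        ∃ x ∈ (affineSpan ℝ F : AffineSubspace ℝ (Fin n → ℝ)),
          ∀ j, IsPadic p (x j)) →
      (∀ F, IsFace P F → F.Nonempty → ∃ x ∈ F, ∀ j, IsPadic p (x j)) := by
    intro h F hF hne
    obtain ⟨x, hx, hx'⟩ := h F hF hne
    exact face_padic hp A b F hF hne x hx' (hspan F x hx)
  have h13 : (∀ F, IsFace P F → F.Nonempty → ∃ x ∈ F, ∀ j, IsPadic p (x j)) →
      (∀ F, IsFace P F → F.Nonempty →
        ∀ z : {i : Fin m // ∀ x ∈ F, ∑ j, (A i j : ℝ) * x j = (b i : ℝ)} → ℝ,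
          (∀ j, ∃ c : ℤ, ∑ i, z i * (A i.1 j : ℝ) = (c : ℝ)) →
          IsPadic p (∑ i, z i * (b i.1 : ℝ))) := by
    intro h F hF hne z hz
    obtain ⟨x, hx, hx'⟩ := h F hF hne
    choose c hc using hz
    have : ∑ i, z i * (b i.1 : ℝ) = ∑ j, (c j : ℝ) * x j := by
      simp only [← hc, Finset.sum_mul]
      rw [Finset.sum_comm]
      refine Finset.sum_congr rfl fun i _ => ?_
      rw [← i.2 x hx, Finset.mul_sum]
      exact Finset.sum_congr rfl fun j _ => by ring
    rw [this]
    exact isPadic_sum hp _ _ fun j _ => (isPadic_int p _).mul' (hx' j)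
  have h31 : (∀ F, IsFace P F → F.Nonempty →
        ∀ z : {i : Fin m // ∀ x ∈ F, ∑ j, (A i j : ℝ) * x j = (b i : ℝ)} → ℝ,
          (∀ j, ∃ c : ℤ, ∑ i, z i * (A i.1 j : ℝ) = (c : ℝ)) →
          IsPadic p (∑ i, z i * (b i.1 : ℝ))) →
      (∀ F, IsFace P F → F.Nonempty → ∃ x ∈ F, ∀ j, IsPadic p (x j)) := by
    intro h F hF hne
    obtain ⟨x, hx, hx'⟩ := padic_solution hp
      (fun (i : {i : Fin m // ∀ x ∈ F, ∑ j, (A i j : ℝ) * x j = (b i : ℝ)}) j => A i.1 j)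
      (fun i => b i.1) (h F hF hne)
    exact face_padic hp A b F hF hne x hx (fun i hi => hx' ⟨i, hi⟩)
  have h14 : (∀ F, IsFace P F → F.Nonempty → ∃ x ∈ F, ∀ j, IsPadic p (x j)) →
      (∀ w : Fin n → ℝ,
        (∃ x, x ∈ P ∧ ∀ x' ∈ P, ∑ j, w j * x' j ≤ ∑ j, w j * x j) →
        (∃ x, (x ∈ P ∧ ∀ x' ∈ P, ∑ j, w j * x' j ≤ ∑ j, w j * x j) ∧
          ∀ j, IsPadic p (x j))) := by
    rintro h w ⟨x, hx, hmax⟩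
    obtain ⟨y, hy, hy'⟩ := h {y ∈ P | ∑ j, w j * y j = ∑ j, w j * x j}
      ⟨w, _, hmax, rfl⟩ ⟨x, hx, rfl⟩
    exact ⟨y, ⟨hy.1, fun x' hx' => (hmax x' hx').trans hy.2.ge⟩, hy'⟩
  have h41 : (∀ w : Fin n → ℝ,
        (∃ x, x ∈ P ∧ ∀ x' ∈ P, ∑ j, w j * x' j ≤ ∑ j, w j * x j) →
        (∃ x, (x ∈ P ∧ ∀ x' ∈ P, ∑ j, w j * x' j ≤ ∑ j, w j * x j) ∧
          ∀ j, IsPadic p (x j))) →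
      (∀ F, IsFace P F → F.Nonempty → ∃ x ∈ F, ∀ j, IsPadic p (x j)) := by
    rintro h F ⟨c, δ, hc, rfl⟩ ⟨x, hx, hxδ⟩
    obtain ⟨y, ⟨hy, hmax⟩, hy'⟩ := h c ⟨x, hx, fun x' hx' => (hc x' hx').trans hxδ.ge⟩
    exact ⟨y, ⟨hy, le_antisymm (hc y hy) (hxδ.ge.trans (hmax x hx))⟩, hy'⟩
  refine ⟨⟨h12, h21⟩, ⟨h13, h31⟩, ⟨h14, h41⟩, ?_, ?_⟩
  · rintro h w x ⟨hx, hmax⟩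
    obtain ⟨y, ⟨hy, hymax⟩, hy'⟩ := h14 h (fun j => (w j : ℝ)) ⟨x, hx, hmax⟩
    rw [le_antisymm (hymax x hx) (hmax y hy)]
    exact isPadic_sum hp _ _ fun j _ => (isPadic_int p _).mul' (hy' j)
  · intro h
    apply h31
    rintro F hF ⟨x, hx⟩ z hz
    have hFP : ∀ y ∈ F, y ∈ P := by
      obtain ⟨c, δ, hc, rfl⟩ := hF
      exact fun y hy => hy.1
    choose c hc using hz
    obtain ⟨N, hN⟩ : ∃ N : ℤ, ∀ i, 0 ≤ z i + (N : ℝ) := by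
      obtain ⟨N, hN⟩ := exists_nat_ge (∑ i, |z i|)
      refine ⟨N, fun i => ?_⟩
      have h1 := Finset.single_le_sum (f := fun i => |z i|) (fun i _ => abs_nonneg _)
        (Finset.mem_univ i)
      have h2 := neg_abs_le (z i)
      simp only [Int.cast_natCast]
      linarith
    have hval : ∀ y : Fin n → ℝ, ∑ j, ((c j + N * ∑ i :
          {i : Fin m // ∀ x ∈ F, ∑ j, (A i j : ℝ) * x j = (b i : ℝ)}, A i.1 j : ℤ) : ℝ) * y j =
        ∑ i, (z i + (N : ℝ)) * ∑ j, (A i.1 j : ℝ) * y j := by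
      intro y
      push_cast
      simp only [← hc, Finset.mul_sum, ← Finset.sum_add_distrib, Finset.sum_mul]
      rw [Finset.sum_comm]
      exact Finset.sum_congr rfl fun i _ => Finset.sum_congr rfl fun j _ => by ring
    have hpad := h _ x ⟨hFP x hx, fun x' hx' => by
      rw [hval, hval]
      refine Finset.sum_le_sum fun i _ => mul_le_mul_of_nonneg_left ?_ (hN i)
      rw [i.2 x hx]
      exact hx' i.1⟩
    rw [hval] at hpad
    have hfin : ∑ i, z i * (b i.1 : ℝ) = (∑ i, (z i + (N : ℝ)) * ∑ j, (A i.1 j : ℝ) * x j) +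
        ((-(N * ∑ i : {i : Fin m // ∀ x ∈ F, ∑ j, (A i j : ℝ) * x j = (b i : ℝ)}, b i.1) : ℤ)
          : ℝ) := by
      push_cast
      rw [Finset.mul_sum, ← Finset.sum_neg_distrib, ← Finset.sum_add_distrib]
      refine Finset.sum_congr rfl fun i _ => ?_
      rw [i.2 x hx]
      ring
    rw [hfin]
    exact hpad.add' hp (isPadic_int p _)
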